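/- arXiv:0812.1110 — 6 statements merged into one kernel-verified Lean document; each statement's English description precedes it below -/
import Mathlib

section
/- Let λ > 0, a₀ > 0 and a₁ ∈ ℝ. There is no twice continuously differentiable function a : [0,∞) → ℝ with a(t) > 0 for all t ≥ 0 satisfying the Emden equation a''(t) = -λ/a(t) with a(0) = a₀ and a'(0) = a₁. Equivalently, any maximal positive solution of this initial value problem reaches a(T₋) = 0 at some finite time T₋ < +∞. -/
/-- A function on `[0, ∞)` whose derivative is at most `c` from `s` on lies below the line of
slope `c` through its value at `s`. -/
theorem le_add_mul_sub_of_hasDerivWithinAt_le {f f' : ℝ → ℝ} {c s t : ℝ} (hs : 0 ≤ s)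
    (hst : s ≤ t) (hf : ∀ x ∈ Set.Ici (0 : ℝ), HasDerivWithinAt f (f' x) (Set.Ici 0) x)
    (hc : ∀ x, s ≤ x → f' x ≤ c) : f t ≤ f s + c * (t - s) := by
  have hderiv : ∀ x ∈ interior (Set.Ici s), HasDerivAt f (f' x) x := by
    intro x hx
    rw [interior_Ici] at hx
    have hx0 : 0 < x := hs.trans_lt hx
    exact (hf x hx0.le).hasDerivAt (Ici_mem_nhds hx0)
  have key := (convex_Ici s).image_sub_le_mul_sub_of_deriv_le
    (fun x hx => ((hf x (hs.trans hx)).continuousWithinAt).mono (Set.Ici_subset_Ici.2 hs))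
    (fun x hx => (hderiv x hx).differentiableAt.differentiableWithinAt)
    (fun x hx => (hderiv x hx).deriv ▸ hc x (interior_subset hx))
    s Set.self_mem_Ici t hst hst
  linarith

/-- If `f'` is antitone and `f` stays positive on `[0, ∞)`, then `f'` is nonnegative there. -/
theorem deriv_nonneg_of_pos_of_antitone {f f' : ℝ → ℝ} (hpos : ∀ t ∈ Set.Ici (0 : ℝ), 0 < f t)
    (hf : ∀ t ∈ Set.Ici (0 : ℝ), HasDerivWithinAt f (f' t) (Set.Ici 0) t)
    (hanti : ∀ s t, 0 ≤ s → s ≤ t → f' t ≤ f' s) {s : ℝ} (hs : 0 ≤ s) : 0 ≤ f' s := by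
  by_contra! hneg
  have hfs : 0 < f s := hpos s hs
  have hstep : 0 ≤ f s / -f' s := div_nonneg hfs.le (by linarith)
  have hline := le_add_mul_sub_of_hasDerivWithinAt_le hs (le_add_of_nonneg_right hstep) hf
    (hanti s · hs)
  have hzero : f s + f' s * (s + f s / -f' s - s) = 0 := by
    have := hneg.ne
    field_simp
    ring
  have := hpos (s + f s / -f' s) (add_nonneg hs hstep)
  linarith

/- STATEMENT 1: For `λ > 0`, `a₀ > 0`, `a₁ ∈ ℝ`, there is no (twice continuously differentiable)
positive function `a : [0,∞) → ℝ` solving the Emden equation `a'' = -λ/a`, `a(0) = a₀`,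
`a'(0) = a₁` globally on `[0,∞)`; i.e. any positive solution must break down (reach zero) in
finite time. -/
theorem emden_no_global_positive_solution (lam a₀ a₁ : ℝ) (hlam : 0 < lam) (ha₀ : 0 < a₀) :
    ¬ ∃ (a a' : ℝ → ℝ),
        (∀ t ∈ Set.Ici (0 : ℝ), 0 < a t) ∧
        (∀ t ∈ Set.Ici (0 : ℝ), HasDerivWithinAt a (a' t) (Set.Ici 0) t) ∧
        (∀ t ∈ Set.Ici (0 : ℝ), HasDerivWithinAt a' (-lam / a t) (Set.Ici 0) t) ∧
        a 0 = a₀ ∧ a' 0 = a₁ := by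
  rintro ⟨a, a', hpos, ha, ha', -, -⟩
  have hanti : ∀ s t, 0 ≤ s → s ≤ t → a' t ≤ a' s := fun s t hs hst => by
    simpa using le_add_mul_sub_of_hasDerivWithinAt_le (c := 0) hs hst ha' fun x hx =>
      div_nonpos_of_nonpos_of_nonneg (neg_nonpos.2 hlam.le) (hpos x (hs.trans hx)).le
  have hnonneg : ∀ s, 0 ≤ s → 0 ≤ a' s := fun s hs =>
    deriv_nonneg_of_pos_of_antitone hpos ha hanti hs
  have henergy : ∀ t, 0 ≤ t →
      a' t ^ 2 / 2 + lam * Real.log (a t) ≤ a' 0 ^ 2 / 2 + lam * Real.log (a 0) := by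
    intro t ht
    have hE : ∀ x ∈ Set.Ici (0 : ℝ), HasDerivWithinAt
        (fun t => a' t ^ 2 / 2 + lam * Real.log (a t)) 0 (Set.Ici 0) x := by
      intro x hx
      have hax := (hpos x hx).ne'
      refine ((((ha' x hx).fun_pow 2).div_const 2).fun_add
        (((ha x hx).log hax).const_mul lam)).congr_deriv ?_
      field_simp
      ring
    simpa using le_add_mul_sub_of_hasDerivWithinAt_le (c := 0) le_rfl ht hE fun _ _ => le_rfl
  obtain ⟨M, hM, hbound⟩ : ∃ M, 0 < M ∧ ∀ t, 0 ≤ t → a t ≤ M := by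
    refine ⟨_, Real.exp_pos ((a' 0 ^ 2 / 2 + lam * Real.log (a 0)) / lam), fun t ht => ?_⟩
    rw [← Real.log_le_iff_le_exp (hpos t ht), le_div_iff₀ hlam]
    nlinarith [henergy t ht, sq_nonneg (a' t)]
  have hT : 0 ≤ (a' 0 + 1) * M / lam :=
    div_nonneg (mul_nonneg (by linarith [hnonneg 0 le_rfl]) hM.le) hlam.le
  have hline := le_add_mul_sub_of_hasDerivWithinAt_le (c := -lam / M) le_rfl hT ha' fun x hx => by
    rw [neg_div, neg_div, neg_le_neg_iff]
    exact div_le_div_of_nonneg_left hlam.le (hpos x hx) (hbound x hx)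
  have hvalue : a' 0 + -lam / M * ((a' 0 + 1) * M / lam - 0) = -1 := by
    field_simp
    ring
  linarith [hnonneg _ hT]
end

section
/- Let σ > 0, μ ∈ ℝ and α ∈ ℝ. Then there exists x₀ > 0 and a C² function y : [0,x₀] → ℝ with y(0) = α and y'(0) = 0 (derivative from the right) such that for all x ∈ (0,x₀]: y''(x) + (1/x)·y'(x) + σ·e^{y(x)} = μ. -/
/-- The average of `h` over the segment from `0` to `x`, against the weight `t` on `[0, 1]`. -/
noncomputable def weightedAverage (h : ℝ → ℝ) (x : ℝ) : ℝ := ∫ t in (0 : ℝ)..1, t * h (t * x)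

theorem continuous_weightedAverage {h : ℝ → ℝ} (hh : Continuous h) :
    Continuous (weightedAverage h) := by
  unfold weightedAverage
  apply intervalIntegral.continuous_parametric_intervalIntegral_of_continuous'
  simp only [Function.uncurry_def]
  fun_prop

theorem weightedAverage_zero (h : ℝ → ℝ) : weightedAverage h 0 = h 0 / 2 := by
  simp [weightedAverage]
  ring

theorem abs_weightedAverage_sub_le {h k : ℝ → ℝ} (hh : Continuous h) (hk : Continuous k)
    {C : ℝ} (hC : ∀ x, |h x - k x| ≤ C) (x : ℝ) :
    |weightedAverage h x - weightedAverage k x| ≤ C := by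
  have hC0 : 0 ≤ C := (abs_nonneg _).trans (hC 0)
  unfold weightedAverage
  rw [← intervalIntegral.integral_sub
    (Continuous.intervalIntegrable (by fun_prop) _ _)
    (Continuous.intervalIntegrable (by fun_prop) _ _)]
  have := intervalIntegral.norm_integral_le_of_norm_le_const (a := (0 : ℝ)) (b := 1) (C := C)
    (f := fun t => t * h (t * x) - t * k (t * x)) (fun t ht => by
      rw [Set.uIoc_of_le zero_le_one] at ht
      rw [← mul_sub, norm_mul, Real.norm_eq_abs, Real.norm_eq_abs, abs_of_pos ht.1]
      nlinarith [hC (t * x), abs_nonneg (h (t * x) - k (t * x)), ht.2, ht.1])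
  simpa using this

theorem mul_mul_weightedAverage (h : ℝ → ℝ) (x : ℝ) :
    x * (x * weightedAverage h x) = ∫ s in (0 : ℝ)..x, s * h s := by
  have := intervalIntegral.mul_integral_comp_mul_right (a := 0) (b := 1) (f := fun s => s * h s) (c := x)
  rw [zero_mul, one_mul] at this
  rw [← this, weightedAverage, ← intervalIntegral.integral_const_mul]
  congr 2
  ext t
  ring

theorem hasDerivAt_mul_weightedAverage {h : ℝ → ℝ} (hh : Continuous h) (x : ℝ) :
    HasDerivAt (fun x => x * weightedAverage h x) (h x - weightedAverage h x) x := by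
  rcases eq_or_ne x 0 with rfl | hx
  · have hlim : h 0 - weightedAverage h 0 = weightedAverage h 0 := by
      rw [weightedAverage_zero]; ring
    rw [hlim, hasDerivAt_iff_tendsto_slope]
    refine ((continuous_weightedAverage hh).tendsto 0 |>.mono_left nhdsWithin_le_nhds).congr' ?_
    filter_upwards [self_mem_nhdsWithin] with y hy
    have hy : y ≠ 0 := hy
    simp [slope_def_field, hy]
  · have hint : HasDerivAt (fun x => ∫ s in (0 : ℝ)..x, s * h s) (x * h x) x :=
      intervalIntegral.integral_hasDerivAt_right
        (Continuous.intervalIntegrable (by fun_prop) _ _)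
        (Continuous.stronglyMeasurableAtFilter (by fun_prop) _ _)
        (Continuous.continuousAt (by fun_prop))
    have hdiv := hint.div (hasDerivAt_id x) hx
    have hval : h x - weightedAverage h x
        = (x * h x * id x - (∫ s in (0 : ℝ)..x, s * h s) * 1) / id x ^ 2 := by
      rw [← mul_mul_weightedAverage, id]
      field_simp
    rw [hval]
    refine hdiv.congr_of_eventuallyEq ?_
    filter_upwards [isOpen_ne.mem_nhds hx] with y hy
    have hy : y ≠ 0 := hy
    simp [← mul_mul_weightedAverage, hy]

/-- The solution of `y'' + y' / x = h`, `y 0 = α`, `y' 0 = 0`. -/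
noncomputable def radialSolution (α : ℝ) (h : ℝ → ℝ) (x : ℝ) : ℝ :=
  α + ∫ s in (0 : ℝ)..x, s * weightedAverage h s

theorem hasDerivAt_radialSolution (α : ℝ) {h : ℝ → ℝ} (hh : Continuous h) (x : ℝ) :
    HasDerivAt (radialSolution α h) (x * weightedAverage h x) x := by
  have hc := continuous_weightedAverage hh
  exact (intervalIntegral.integral_hasDerivAt_right
    (Continuous.intervalIntegrable (by fun_prop) _ _)
    (Continuous.stronglyMeasurableAtFilter (by fun_prop) _ _)
    (Continuous.continuousAt (by fun_prop))).const_add α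

theorem continuous_radialSolution (α : ℝ) {h : ℝ → ℝ} (hh : Continuous h) :
    Continuous (radialSolution α h) :=
  continuous_iff_continuousAt.2 fun x => (hasDerivAt_radialSolution α hh x).continuousAt

theorem contDiff_two_radialSolution (α : ℝ) {h : ℝ → ℝ} (hh : Continuous h) :
    ContDiff ℝ 2 (radialSolution α h) := by
  have hd : deriv (radialSolution α h) = fun x => x * weightedAverage h x :=
    funext fun x => (hasDerivAt_radialSolution α hh x).deriv
  have hd' : deriv (fun x => x * weightedAverage h x) = fun x => h x - weightedAverage h x :=
    funext fun x => (hasDerivAt_mul_weightedAverage hh x).deriv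
  rw [show (2 : WithTop ℕ∞) = 1 + 1 by norm_num, contDiff_succ_iff_deriv]
  refine ⟨fun x => (hasDerivAt_radialSolution α hh x).differentiableAt, by simp, ?_⟩
  rw [hd, contDiff_one_iff_deriv, hd']
  exact ⟨fun x => (hasDerivAt_mul_weightedAverage hh x).differentiableAt,
    hh.sub (continuous_weightedAverage hh)⟩

theorem abs_radialSolution_sub_le (α : ℝ) {h k : ℝ → ℝ} (hh : Continuous h) (hk : Continuous k)
    {C : ℝ} (hC : ∀ x, |h x - k x| ≤ C) {x : ℝ} (hx : 0 ≤ x) :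
    |radialSolution α h x - radialSolution α k x| ≤ x * C * x := by
  have hch := continuous_weightedAverage hh
  have hck := continuous_weightedAverage hk
  unfold radialSolution
  rw [add_sub_add_left_eq_sub, ← intervalIntegral.integral_sub
    (Continuous.intervalIntegrable (by fun_prop) _ _)
    (Continuous.intervalIntegrable (by fun_prop) _ _)]
  have := intervalIntegral.norm_integral_le_of_norm_le_const (a := 0) (b := x) (C := x * C)
    (f := fun s => s * weightedAverage h s - s * weightedAverage k s) (fun s hs => by
      rw [Set.uIoc_of_le hx] at hs
      rw [← mul_sub, norm_mul, Real.norm_eq_abs, Real.norm_eq_abs, abs_of_pos hs.1]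
      exact mul_le_mul hs.2 (abs_weightedAverage_sub_le hh hk hC s) (abs_nonneg _) hx)
  simpa [abs_of_nonneg hx] using this

theorem abs_exp_min_sub_exp_min_le (B a b : ℝ) :
    |Real.exp (min a B) - Real.exp (min b B)| ≤ Real.exp B * |a - b| := by
  have hexp := (convex_Iic B).norm_image_sub_le_of_norm_deriv_le (f := Real.exp)
    (C := Real.exp B) (fun x _ => Real.differentiableAt_exp)
    (fun x hx => by simpa using hx) (min_le_right b B) (min_le_right a B)
  refine hexp.trans (mul_le_mul_of_nonneg_left ?_ (Real.exp_pos B).le)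
  exact abs_inf_sub_inf_le_abs a b B

/-- A bounded, globally Lipschitz nonlinearity admits a short-time solution of
`y'' + y' / x = G y`, `y 0 = α`, `y' 0 = 0`, given here through its right-hand side. -/
theorem exists_eq_comp_radialSolution (α : ℝ) {G : ℝ → ℝ} {M C : ℝ} (hM : 0 ≤ M)
    (hG : ∀ a b, |G a - G b| ≤ M * |a - b|) (hGC : ∀ a b, dist (G a) (G b) ≤ C) :
    ∃ x₀ : ℝ, 0 < x₀ ∧ ∃ h : ℝ → ℝ, Continuous h ∧
      ∀ x ∈ Set.Icc 0 x₀, h x = G (radialSolution α h x) := by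
  have hGc : Continuous G :=
    (LipschitzWith.of_dist_le_mul (K := ⟨M, hM⟩) fun a b => hG a b).continuous
  set x₀ : ℝ := 1 / (1 + 2 * M) with hx₀
  have hx₀pos : 0 < x₀ := by positivity
  have hx₀le : x₀ ≤ 1 := by
    rw [hx₀, div_le_one (by positivity)]; linarith
  have hMx : M * x₀ ≤ 1 / 2 := by
    rw [hx₀, mul_one_div, div_le_div_iff₀ (by positivity) (by positivity)]; linarith
  let Φ : BoundedContinuousFunction ℝ ℝ → BoundedContinuousFunction ℝ ℝ := fun h =>
    BoundedContinuousFunction.mkOfBound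
      ⟨fun x => G (radialSolution α h (max 0 (min x x₀))),
        hGc.comp ((continuous_radialSolution α h.continuous).comp (by fun_prop))⟩
      C (fun _ _ => hGC _ _)
  have hΦ : ContractingWith (1 / 2) Φ := by
    refine ⟨by norm_num, LipschitzWith.of_dist_le_mul fun h k => ?_⟩
    refine (BoundedContinuousFunction.dist_le (by positivity)).2 fun x => ?_
    set c := max 0 (min x x₀)
    have hc0 : 0 ≤ c := le_max_left _ _
    have hc1 : c ≤ x₀ := max_le hx₀pos.le (min_le_right _ _)
    have hd : 0 ≤ dist h k := dist_nonneg
    have hsol := abs_radialSolution_sub_le α h.continuous k.continuous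
      (fun x => BoundedContinuousFunction.dist_coe_le_dist (f := h) (g := k) x) hc0
    calc dist (Φ h x) (Φ k x)
        ≤ M * |radialSolution α h c - radialSolution α k c| := hG _ _
      _ ≤ M * (c * dist h k * c) := by gcongr
      _ ≤ M * (x₀ * dist h k * 1) := by gcongr; exact hc1.trans hx₀le
      _ = M * x₀ * dist h k := by ring
      _ ≤ 1 / 2 * dist h k := by gcongr
      _ = _ := by simp
  obtain ⟨h, hfix⟩ : ∃ h, Φ h = h := ⟨_, hΦ.fixedPoint_isFixedPt⟩
  refine ⟨x₀, hx₀pos, h, h.continuous, fun x hx => ?_⟩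
  rw [← DFunLike.congr_fun hfix x]
  change G (radialSolution α _ (max 0 (min x x₀))) = _
  rw [min_eq_left hx.2, max_eq_right hx.1]


/- STATEMENT 4: Local existence for the singular elliptic ODE
`y'' + (1/x)·y' + σ·e^y = μ`, `y(0) = α`, `y'(0) = 0` (right derivative at `0`):
there exist `x₀ > 0` and a `C²` solution `y` on `[0, x₀]`. -/
theorem elliptic_ode_local_existence (σ μ α : ℝ) (hσ : 0 < σ) :
    ∃ x₀ : ℝ, 0 < x₀ ∧ ∃ y : ℝ → ℝ,
      ContDiffOn ℝ 2 y (Set.Icc 0 x₀) ∧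
      y 0 = α ∧
      derivWithin y (Set.Icc 0 x₀) 0 = 0 ∧
      ∀ x ∈ Set.Ioc (0 : ℝ) x₀,
        derivWithin (derivWithin y (Set.Icc 0 x₀)) (Set.Icc 0 x₀) x
          + (1 / x) * derivWithin y (Set.Icc 0 x₀) x
          + σ * Real.exp (y x) = μ := by
  obtain ⟨x₁, hx₁, h, hh, hfix⟩ := exists_eq_comp_radialSolution α
    (G := fun a => μ - σ * Real.exp (min a (α + 1))) (M := σ * Real.exp (α + 1))
    (C := σ * Real.exp (α + 1)) (by positivity)
    (fun a b => by
      rw [sub_sub_sub_cancel_left, ← mul_sub, abs_mul, abs_of_pos hσ, mul_assoc, abs_sub_comm a b]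
      exact mul_le_mul_of_nonneg_left (abs_exp_min_sub_exp_min_le _ _ _) hσ.le)
    (fun a b => by
      rw [Real.dist_eq, sub_sub_sub_cancel_left, ← mul_sub, abs_mul, abs_of_pos hσ]
      refine mul_le_mul_of_nonneg_left (abs_sub_le_of_nonneg_of_le ?_ ?_ ?_ ?_) hσ.le
      all_goals first | positivity | exact Real.exp_le_exp.2 (min_le_right _ _))
  have hy0 : radialSolution α h 0 = α := by simp [radialSolution]
  have hnear : ∀ᶠ x in nhds 0, radialSolution α h x < α + 1 :=
    (continuous_radialSolution α hh).continuousAt.eventually_lt continuousAt_const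
      (by rw [hy0]; linarith)
  obtain ⟨ε, hε, hball⟩ := Metric.eventually_nhds_iff.1 hnear
  have hx₀ : 0 < min x₁ (ε / 2) := by positivity
  set x₀ := min x₁ (ε / 2)
  have hd : ∀ x ∈ Set.Icc 0 x₀, derivWithin (radialSolution α h) (Set.Icc 0 x₀) x
      = x * weightedAverage h x := fun x hx =>
    (hasDerivAt_radialSolution α hh x).hasDerivWithinAt.derivWithin (uniqueDiffOn_Icc hx₀ x hx)
  refine ⟨x₀, hx₀, radialSolution α h, (contDiff_two_radialSolution α hh).contDiffOn, hy0, ?_, ?_⟩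
  · rw [hd 0 (Set.left_mem_Icc.2 hx₀.le), zero_mul]
  · intro x hx
    have hxI : x ∈ Set.Icc 0 x₀ := Set.Ioc_subset_Icc_self hx
    have hle : radialSolution α h x < α + 1 := hball (by
      rw [Real.dist_0_eq_abs, abs_of_pos hx.1]
      linarith [hx.2, min_le_right x₁ (ε / 2)])
    have hhx := hfix x ⟨hxI.1, hxI.2.trans (min_le_left _ _)⟩
    rw [min_eq_left hle.le] at hhx
    rw [derivWithin_congr hd (hd x hxI), hd x hxI,
      (hasDerivAt_mul_weightedAverage hh x).hasDerivWithinAt.derivWithin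
        (uniqueDiffOn_Icc hx₀ x hxI), hhx]
    have := hx.1.ne'
    field_simp
    ring
end

section
/- Let σ > 0 and α ∈ ℝ. Then there exists a C² function y : [0,∞) → ℝ with y(0) = α and y'(0) = 0 (derivative from the right) satisfying y''(x) + (1/x)·y'(x) + σ·e^{y(x)} = 0 for all x > 0, and moreover y(x) → -∞ as x → +∞. -/
/-- The radial Liouville profile `x ↦ α - 2 log (1 + c x²)`. -/
noncomputable def liouvilleProfile (c α x : ℝ) : ℝ := α - 2 * Real.log (1 + c * x ^ 2)

section LiouvilleProfile

variable {c : ℝ}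

lemma one_add_mul_sq_pos (hc : 0 < c) (x : ℝ) : 0 < 1 + c * x ^ 2 := by positivity

lemma hasDerivAt_one_add_mul_sq (c x : ℝ) :
    HasDerivAt (fun t : ℝ => 1 + c * t ^ 2) (2 * c * x) x := by
  refine (((hasDerivAt_pow 2 x).const_mul c).const_add 1).congr_deriv ?_
  norm_num
  ring

lemma contDiff_liouvilleProfile (hc : 0 < c) (α : ℝ) {n : WithTop ℕ∞} :
    ContDiff ℝ n (liouvilleProfile c α) := by
  have h : ContDiff ℝ n fun x : ℝ => 1 + c * x ^ 2 := by fun_prop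
  exact contDiff_const.sub (contDiff_const.mul (h.log fun x => (one_add_mul_sq_pos hc x).ne'))

lemma hasDerivAt_liouvilleProfile (hc : 0 < c) (α x : ℝ) :
    HasDerivAt (liouvilleProfile c α) (-(4 * c * x) / (1 + c * x ^ 2)) x := by
  have h := (((hasDerivAt_one_add_mul_sq c x).log
    (one_add_mul_sq_pos hc x).ne').const_mul 2).const_sub α
  exact h.congr_deriv (by ring)

lemma hasDerivAt_deriv_liouvilleProfile (hc : 0 < c) (x : ℝ) :
    HasDerivAt (fun t : ℝ => -(4 * c * t) / (1 + c * t ^ 2))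
      ((-(4 * c) * (1 + c * x ^ 2) + 4 * c * x * (2 * c * x)) / (1 + c * x ^ 2) ^ 2) x := by
  have h := (((hasDerivAt_id x).const_mul (4 * c)).neg).div
    (hasDerivAt_one_add_mul_sq c x) (one_add_mul_sq_pos hc x).ne'
  refine h.congr_deriv ?_
  simp

lemma derivWithin_liouvilleProfile (hc : 0 < c) (α : ℝ) {x : ℝ} (hx : x ∈ Set.Ici (0 : ℝ)) :
    derivWithin (liouvilleProfile c α) (Set.Ici 0) x = -(4 * c * x) / (1 + c * x ^ 2) :=
  (hasDerivAt_liouvilleProfile hc α x).hasDerivWithinAt.derivWithin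
    (uniqueDiffOn_Ici 0 x hx)

lemma derivWithin_derivWithin_liouvilleProfile (hc : 0 < c) (α : ℝ) {x : ℝ}
    (hx : x ∈ Set.Ici (0 : ℝ)) :
    derivWithin (derivWithin (liouvilleProfile c α) (Set.Ici 0)) (Set.Ici 0) x =
      (-(4 * c) * (1 + c * x ^ 2) + 4 * c * x * (2 * c * x)) / (1 + c * x ^ 2) ^ 2 := by
  rw [derivWithin_congr (fun t ht => derivWithin_liouvilleProfile hc α ht)
    (derivWithin_liouvilleProfile hc α hx)]
  exact (hasDerivAt_deriv_liouvilleProfile hc x).hasDerivWithinAt.derivWithin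
    (uniqueDiffOn_Ici 0 x hx)

lemma exp_liouvilleProfile (hc : 0 < c) (α x : ℝ) :
    Real.exp (liouvilleProfile c α x) = Real.exp α / (1 + c * x ^ 2) ^ 2 := by
  rw [liouvilleProfile, Real.exp_sub, two_mul, Real.exp_add,
    Real.exp_log (one_add_mul_sq_pos hc x), sq (1 + c * x ^ 2)]

lemma tendsto_liouvilleProfile_atTop (hc : 0 < c) (α : ℝ) :
    Filter.Tendsto (liouvilleProfile c α) Filter.atTop Filter.atBot := by
  have h : Filter.Tendsto (fun x : ℝ => 1 + c * x ^ 2) Filter.atTop Filter.atTop :=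
    Filter.tendsto_atTop_add_const_left _ _
      ((Filter.tendsto_pow_atTop two_ne_zero).const_mul_atTop hc)
  have hlog := (Real.tendsto_log_atTop.comp h).const_mul_atTop (zero_lt_two' ℝ)
  have hneg := Filter.tendsto_atBot_add_const_left _ α (Filter.tendsto_neg_atTop_atBot.comp hlog)
  exact hneg.congr fun x => (sub_eq_add_neg _ _).symm

end LiouvilleProfile

/- STATEMENT 5: Global existence for the singular elliptic ODE
`y'' + (1/x)·y' + σ·e^y = 0`, `y(0) = α`, `y'(0) = 0` (right derivative at `0`):
there is a `C²` solution `y` on `[0,∞)` and moreover `y(x) → -∞` as `x → +∞`. -/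
theorem elliptic_ode_global_existence_mu_zero (σ α : ℝ) (hσ : 0 < σ) :
    ∃ y : ℝ → ℝ,
      ContDiffOn ℝ 2 y (Set.Ici 0) ∧
      y 0 = α ∧
      derivWithin y (Set.Ici 0) 0 = 0 ∧
      (∀ x : ℝ, 0 < x →
        derivWithin (derivWithin y (Set.Ici 0)) (Set.Ici 0) x
          + (1 / x) * derivWithin y (Set.Ici 0) x
          + σ * Real.exp (y x) = 0) ∧
      Filter.Tendsto y Filter.atTop Filter.atBot := by
  have hc : 0 < σ * Real.exp α / 8 := by positivity
  refine ⟨liouvilleProfile (σ * Real.exp α / 8) α, (contDiff_liouvilleProfile hc α).contDiffOn,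
    by simp [liouvilleProfile], ?_, fun x hx => ?_, tendsto_liouvilleProfile_atTop hc α⟩
  · simp [derivWithin_liouvilleProfile hc α Set.self_mem_Ici]
  · rw [derivWithin_derivWithin_liouvilleProfile hc α hx.le,
      derivWithin_liouvilleProfile hc α hx.le, exp_liouvilleProfile hc]
    have hσα : σ * (Real.exp α / (1 + σ * Real.exp α / 8 * x ^ 2) ^ 2) =
        8 * (σ * Real.exp α / 8) / (1 + σ * Real.exp α / 8 * x ^ 2) ^ 2 := by ring
    rw [hσα]
    generalize σ * Real.exp α / 8 = c at hc ⊢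
    have hne := (one_add_mul_sq_pos hc x).ne'
    field_simp
    ring
end

section
/- Let σ > 0, α, α₀ ∈ ℝ, X ∈ (0,∞], and let y : [0,X) → ℝ be a C² function with y(0) = α and y'(0) = 0 satisfying y''(x) + (1/x)·y'(x) + σ·e^{y(x)} = 0 for all x ∈ (0,X). If y(x) ≥ α₀ for all x ∈ [0,X), then y(x) ≤ α - (σ·e^{α₀}/4)·x² for all x ∈ [0,X). In particular, no solution of this equation on [0,∞) can be bounded below. -/
/-- The half-open interval `[0, X)` for `X ∈ (0, ∞]` (modelled in `EReal`). -/
def spaceInterval (X : EReal) : Set ℝ := {x : ℝ | 0 ≤ x ∧ (x : EReal) < X}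

theorem convex_spaceInterval (X : EReal) : Convex ℝ (spaceInterval X) := by
  refine Set.OrdConnected.convex ⟨fun a ha b hb z hz => ⟨ha.1.trans hz.1, ?_⟩⟩
  exact (EReal.coe_le_coe_iff.2 hz.2).trans_lt hb.2

theorem zero_mem_spaceInterval {X : EReal} (hX : 0 < X) : (0 : ℝ) ∈ spaceInterval X :=
  ⟨le_rfl, by simpa using hX⟩

theorem uniqueDiffOn_spaceInterval {X : EReal} (hX : 0 < X) :
    UniqueDiffOn ℝ (spaceInterval X) := by
  refine uniqueDiffOn_convex (convex_spaceInterval X) ?_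
  obtain ⟨b, hb0, hbX⟩ := EReal.lt_iff_exists_real_btwn.1 hX
  have hb : (0 : ℝ) < b := by exact_mod_cast hb0
  refine Set.Nonempty.mono (interior_maximal (s := spaceInterval X) (t := Set.Ioo 0 b)
    (fun z hz => ⟨hz.1.le, ?_⟩) isOpen_Ioo) (Set.nonempty_Ioo.2 hb)
  exact (EReal.coe_lt_coe_iff.2 hz.2).trans hbX

theorem pos_of_mem_interior_spaceInterval {X : EReal} {x : ℝ}
    (hx : x ∈ interior (spaceInterval X)) : 0 < x := by
  have h := interior_mono (show spaceInterval X ⊆ Set.Ici 0 from fun z hz => hz.1) hx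
  rwa [interior_Ici] at h

/- STATEMENT 7: For a `C²` solution `y` on `[0,X)`, `X ∈ (0,∞]`, of
`y'' + (1/x)·y' + σ·e^y = 0`, `y(0) = α`, `y'(0) = 0`: if `y ≥ α₀` on `[0,X)` then
`y(x) ≤ α - (σ·e^{α₀}/4)·x²` on `[0,X)`; in particular no such solution defined on all of
`[0,∞)` (i.e. `X = ∞`) can be bounded below. -/
theorem elliptic_ode_not_bounded_below (σ α α₀ : ℝ) (hσ : 0 < σ)
    (X : EReal) (hX : 0 < X) (y : ℝ → ℝ)
    (hy : ContDiffOn ℝ 2 y (spaceInterval X))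
    (hy0 : y 0 = α)
    (hy'0 : derivWithin y (spaceInterval X) 0 = 0)
    (hode : ∀ x : ℝ, 0 < x → (x : EReal) < X →
      derivWithin (derivWithin y (spaceInterval X)) (spaceInterval X) x
        + (1 / x) * derivWithin y (spaceInterval X) x
        + σ * Real.exp (y x) = 0)
    (hlb : ∀ x ∈ spaceInterval X, α₀ ≤ y x) :
    (∀ x ∈ spaceInterval X, y x ≤ α - σ * Real.exp α₀ / 4 * x ^ 2) ∧
    (X = ⊤ → False) := by
  have hU := uniqueDiffOn_spaceInterval hX
  have hC := convex_spaceInterval X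
  have h0 := zero_mem_spaceInterval hX
  have hdy : DifferentiableOn ℝ y (spaceInterval X) := hy.differentiableOn (by norm_num)
  have hdg : DifferentiableOn ℝ (derivWithin y (spaceInterval X)) (spaceInterval X) :=
    (hy.derivWithin hU (m := 1) (by norm_num)).differentiableOn (by norm_num)
  set S := spaceInterval X with hS
  set g := derivWithin y S with hg
  set c := σ * Real.exp α₀ with hc
  have hcpos : 0 < c := by positivity
  have hgle : ∀ x ∈ S, 0 < x → g x ≤ -(c / 2 * x) := by
    have hanti : AntitoneOn (fun x => x * g x + c / 2 * x ^ 2) S := by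
      refine antitoneOn_of_hasDerivWithinAt_nonpos hC
        (f' := fun x => 1 * g x + x * derivWithin g S x + c / 2 * (2 * x)) ?_ ?_ ?_
      · exact (continuousOn_id.mul hdg.continuousOn).add (by fun_prop)
      · intro x hx
        have h1 := ((hasDerivAt_id x).hasDerivWithinAt (s := S)).mul
          (hdg x (interior_subset hx)).hasDerivWithinAt
        have h2 := (((hasDerivAt_pow 2 x).const_mul (c / 2)).hasDerivWithinAt (s := S))
        refine ((h1.add h2).mono interior_subset).congr_deriv ?_
        simp
      · intro x hx
        have hxpos := pos_of_mem_interior_spaceInterval hx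
        have hxS := interior_subset hx
        have he := hode x hxpos hxS.2
        have hexp : c ≤ σ * Real.exp (y x) :=
          mul_le_mul_of_nonneg_left (Real.exp_le_exp.2 (hlb x hxS)) hσ.le
        have he' : g x + x * derivWithin g S x = -(x * (σ * Real.exp (y x))) := by
          field_simp at he
          linarith
        have := mul_le_mul_of_nonneg_left hexp hxpos.le
        linarith
    intro x hx hxpos
    have h := hanti h0 hx hxpos.le
    simp only [zero_mul] at h
    have : x * (g x + c / 2 * x) ≤ x * 0 := by linarith
    linarith [le_of_mul_le_mul_left this hxpos]
  have hbound : ∀ x ∈ S, y x ≤ α - c / 4 * x ^ 2 := by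
    have hanti : AntitoneOn (fun x => y x + c / 4 * x ^ 2) S := by
      refine antitoneOn_of_hasDerivWithinAt_nonpos hC
        (f' := fun x => g x + c / 4 * (2 * x)) ?_ ?_ ?_
      · exact hdy.continuousOn.add (by fun_prop)
      · intro x hx
        have h2 := (((hasDerivAt_pow 2 x).const_mul (c / 4)).hasDerivWithinAt (s := S))
        refine (((hdy x (interior_subset hx)).hasDerivWithinAt.add h2).mono
          interior_subset).congr_deriv ?_
        simp [hg]
      · intro x hx
        linarith [hgle x (interior_subset hx) (pos_of_mem_interior_spaceInterval hx)]
    intro x hx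
    have h := hanti h0 hx hx.1
    simp only [hy0] at h
    linarith
  refine ⟨hbound, fun htop => ?_⟩
  have hα : α₀ ≤ α := hy0 ▸ hlb 0 h0
  obtain ⟨t, ht⟩ : ∃ t, t = (α - α₀) * 4 / c := ⟨_, rfl⟩
  have ht0 : 0 ≤ t := ht ▸ div_nonneg (by linarith) hcpos.le
  have hmem : t + 1 ∈ S := ⟨by linarith, by rw [htop]; exact EReal.coe_lt_top _⟩
  have h := (hlb _ hmem).trans (hbound _ hmem)
  have hct : c * t = (α - α₀) * 4 := by rw [ht]; field_simp
  nlinarith [mul_nonneg hcpos.le (mul_nonneg ht0 ht0), mul_nonneg hcpos.le ht0]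
end

section
/- Let K > 0, λ ∈ ℝ, α ∈ ℝ, a₀ > 0, a₁ ∈ ℝ and T ∈ (0,∞]. Let a : [0,T) → ℝ be a C² function with a(t) > 0 for all t ∈ [0,T) satisfying the Emden equation a''(t) = -λ/a(t), a(0) = a₀, a'(0) = a₁, and let y : [0,∞) → ℝ be a C² function with y(0) = α and y'(0) = 0 satisfying y''(x) + (1/x)·y'(x) + (2π/K)·e^{y(x)} = 2λ/K for all x > 0. Define ρ(t,r) = (1/a(t)²)·e^{y(r/a(t))} and u(t,r) = (a'(t)/a(t))·r. Then for all t ∈ [0,T) and r > 0, the pair (ρ,u) satisfies the 2-dimensional isothermal Euler–Poisson equations in radial symmetry: ρ_t + u·ρ_r + ρ·u_r + (1/r)·ρ·u = 0 and ρ·(u_t + u·u_r) + K·ρ_r = -(2π·ρ/r)·∫₀ʳ ρ(t,s)·s ds. -/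
open Real

/-- The half-open time interval `[0, T)` for `T ∈ (0, ∞]` (modelled in `EReal`). -/
def timeInterval (T : EReal) : Set ℝ := {t : ℝ | 0 ≤ t ∧ (t : EReal) < T}

lemma uniqueDiffOn_timeInterval {T : EReal} (hT : 0 < T) : UniqueDiffOn ℝ (timeInterval T) := by
  have hord : (timeInterval T).OrdConnected := by
    refine ⟨fun x hx z hz w hw => ⟨hx.1.trans hw.1, ?_⟩⟩
    exact lt_of_le_of_lt (EReal.coe_le_coe_iff.mpr hw.2) hz.2
  refine uniqueDiffOn_convex hord.convex ?_
  obtain ⟨b, hb0, hbT⟩ := EReal.lt_iff_exists_real_btwn.mp hT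
  have hb : (0 : ℝ) < b := by exact_mod_cast hb0
  refine ⟨b / 2, mem_interior.mpr ⟨Set.Ioo 0 b, fun x hx => ⟨hx.1.le, ?_⟩, isOpen_Ioo, ?_⟩⟩
  · exact (EReal.coe_lt_coe_iff.mpr hx.2).trans hbT
  · constructor <;> linarith

/-- The derivative of a `C²` function within a set of unique differentiability is `C¹` there. -/
lemma ContDiffOn.derivWithin_one {f : ℝ → ℝ} {s : Set ℝ} (hf : ContDiffOn ℝ 2 f s)
    (hs : UniqueDiffOn ℝ s) : ContDiffOn ℝ 1 (derivWithin f s) s :=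
  hf.derivWithin hs (by norm_num)

lemma ContDiffOn.hasDerivAt_Ici {f : ℝ → ℝ} {n : WithTop ℕ∞} (hf : ContDiffOn ℝ n f (Set.Ici 0))
    (hn : n ≠ 0) {x : ℝ} (hx : 0 < x) : HasDerivAt f (derivWithin f (Set.Ici 0) x) x :=
  ((hf.differentiableOn hn) x hx.le).hasDerivWithinAt.hasDerivAt (Ici_mem_nhds hx)

/-- The mass enclosed in radius `r`, obtained by integrating the elliptic equation once. -/
lemma integral_exp_comp_div_mul {K lam : ℝ} (hK : 0 < K) {y : ℝ → ℝ}
    (hy : ContDiffOn ℝ 2 y (Set.Ici 0))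
    (hode : ∀ x : ℝ, 0 < x →
      derivWithin (derivWithin y (Set.Ici 0)) (Set.Ici 0) x
        + (1 / x) * derivWithin y (Set.Ici 0) x
        + (2 * π / K) * Real.exp (y x) = 2 * lam / K)
    {c r : ℝ} (hc : 0 < c) (hr : 0 < r) :
    ∫ s in (0 : ℝ)..r, (1 / c ^ 2 * Real.exp (y (s / c))) * s =
      (lam * (r / c) ^ 2 - K * ((r / c) * derivWithin y (Set.Ici 0) (r / c))) / (2 * π) := by
  have hy' := hy.derivWithin_one (uniqueDiffOn_Ici 0)
  have hmaps : Set.MapsTo (fun s : ℝ => s / c) (Set.Icc 0 r) (Set.Ici 0) :=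
    fun s hs => div_nonneg hs.1 hc.le
  have hdiv : ContinuousOn (fun s : ℝ => s / c) (Set.Icc 0 r) := by fun_prop
  have hyc : ContinuousOn (fun s => y (s / c)) (Set.Icc 0 r) := hy.continuousOn.comp hdiv hmaps
  have hy'c : ContinuousOn (fun s => derivWithin y (Set.Ici 0) (s / c)) (Set.Icc 0 r) :=
    hy'.continuousOn.comp hdiv hmaps
  rw [intervalIntegral.integral_eq_sub_of_hasDerivAt_of_le hr.le
    (f := fun s => (lam * (s / c) ^ 2
      - K * ((s / c) * derivWithin y (Set.Ici 0) (s / c))) / (2 * π))]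
  · simp
  · fun_prop
  · intro s hs
    have hx : 0 < s / c := div_pos hs.1 hc
    have hid : HasDerivAt (fun s : ℝ => s / c) (1 / c) s := (hasDerivAt_id s).div_const c
    have hd := (hy'.hasDerivAt_Ici one_ne_zero hx).comp s hid
    refine ((((hid.pow 2).const_mul lam).sub ((hid.mul hd).const_mul K)).div_const
      (2 * π)).congr_deriv ?_
    have h := hode _ hx
    have hs0 := hs.1.ne'
    have hc0 := hc.ne'
    have hKexp : 2 * π * Real.exp (y (s / c)) = 2 * lam
        - K * derivWithin (derivWithin y (Set.Ici 0)) (Set.Ici 0) (s / c)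
        - K * (c / s) * derivWithin y (Set.Ici 0) (s / c) := by
      field_simp at h ⊢
      linarith
    have hexp := eq_div_of_mul_eq (by positivity) ((mul_comm _ _).trans hKexp)
    simp only [Function.comp_apply, Nat.add_one_sub_one, pow_one]
    rw [hexp]
    field_simp
    ring
  · apply ContinuousOn.intervalIntegrable
    rw [Set.uIcc_of_le hr.le]
    exact (continuousOn_const.mul hyc.rexp).mul continuousOn_id

/- STATEMENT 10: Let `a` be a positive `C²` solution on `[0,T)`, `T ∈ (0,∞]`, of the Emden
equation `a'' = -λ/a`, `a(0) = a₀ > 0`, `a'(0) = a₁`, and let `y` be a `C²` solution on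
`[0,∞)` of `y'' + (1/x)·y' + (2π/K)·e^y = 2λ/K`, `y(0) = α`, `y'(0) = 0`. Then
`ρ(t,r) = (1/a(t)²)·e^{y(r/a(t))}` and `u(t,r) = (a'(t)/a(t))·r` solve the 2-dimensional
isothermal Euler–Poisson equations in radial symmetry:
`ρ_t + u ρ_r + ρ u_r + (1/r) ρ u = 0` and
`ρ(u_t + u u_r) + K ρ_r = -(2πρ/r)·∫₀ʳ ρ(t,s) s ds` for all `t ∈ [0,T)` and `r > 0`. -/
theorem isothermal_euler_poisson_blowup_solution
    (K lam α a₀ a₁ : ℝ) (hK : 0 < K) (ha₀ : 0 < a₀)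
    (T : EReal) (hT : 0 < T) (a y : ℝ → ℝ)
    (ha : ContDiffOn ℝ 2 a (timeInterval T))
    (hapos : ∀ t ∈ timeInterval T, 0 < a t)
    (hemden : ∀ t ∈ timeInterval T,
      derivWithin (derivWithin a (timeInterval T)) (timeInterval T) t = -lam / a t)
    (ha0 : a 0 = a₀)
    (ha1 : derivWithin a (timeInterval T) 0 = a₁)
    (hy : ContDiffOn ℝ 2 y (Set.Ici 0))
    (hy0 : y 0 = α)
    (hy'0 : derivWithin y (Set.Ici 0) 0 = 0)
    (hode : ∀ x : ℝ, 0 < x →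
      derivWithin (derivWithin y (Set.Ici 0)) (Set.Ici 0) x
        + (1 / x) * derivWithin y (Set.Ici 0) x
        + (2 * π / K) * Real.exp (y x) = 2 * lam / K) :
    ∀ t ∈ timeInterval T, ∀ r : ℝ, 0 < r →
      -- continuity equation: ρ_t + u ρ_r + ρ u_r + (1/r) ρ u = 0
      (derivWithin (fun τ => 1 / (a τ) ^ 2 * Real.exp (y (r / a τ))) (timeInterval T) t
          + (derivWithin a (timeInterval T) t / a t * r)
            * deriv (fun s => 1 / (a t) ^ 2 * Real.exp (y (s / a t))) r
          + (1 / (a t) ^ 2 * Real.exp (y (r / a t)))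
            * deriv (fun s => derivWithin a (timeInterval T) t / a t * s) r
          + (1 / r) * (1 / (a t) ^ 2 * Real.exp (y (r / a t)))
            * (derivWithin a (timeInterval T) t / a t * r) = 0) ∧
      -- momentum equation: ρ(u_t + u u_r) + K ρ_r = -(2πρ/r)∫₀ʳ ρ(t,s) s ds
      ((1 / (a t) ^ 2 * Real.exp (y (r / a t)))
          * (derivWithin (fun τ => derivWithin a (timeInterval T) τ / a τ * r)
               (timeInterval T) t
             + (derivWithin a (timeInterval T) t / a t * r)
               * deriv (fun s => derivWithin a (timeInterval T) t / a t * s) r)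
          + K * deriv (fun s => 1 / (a t) ^ 2 * Real.exp (y (s / a t))) r
        = -(2 * π * (1 / (a t) ^ 2 * Real.exp (y (r / a t))) / r)
            * ∫ s in (0 : ℝ)..r, (1 / (a t) ^ 2 * Real.exp (y (s / a t))) * s) := by
  intro t ht r hr
  have hS := uniqueDiffOn_timeInterval hT
  have hat := hapos t ht
  have hat0 := hat.ne'
  have hx : 0 < r / a t := div_pos hr hat
  have hda : HasDerivWithinAt a (derivWithin a (timeInterval T) t) (timeInterval T) t :=
    ((ha.differentiableOn two_ne_zero) t ht).hasDerivWithinAt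
  have hdda : HasDerivWithinAt (derivWithin a (timeInterval T)) (-lam / a t)
      (timeInterval T) t := by
    rw [← hemden t ht]
    exact (((ha.derivWithin_one hS).differentiableOn one_ne_zero) t ht).hasDerivWithinAt
  have hdy := hy.hasDerivAt_Ici two_ne_zero hx
  have hu_r : deriv (fun s => derivWithin a (timeInterval T) t / a t * s) r =
      derivWithin a (timeInterval T) t / a t := by
    simp
  have hρ_r := ((hdy.comp r ((hasDerivAt_id r).div_const (a t))).exp.const_mul
    (1 / (a t) ^ 2)).deriv
  have hρ_t := (((hasDerivWithinAt_const t (timeInterval T) (1 : ℝ)).div (hda.pow 2)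
    (pow_ne_zero 2 hat0)).mul (hdy.comp_hasDerivWithinAt t
      ((hasDerivWithinAt_const t (timeInterval T) r).div hda hat0)).exp).derivWithin (hS t ht)
  have hu_t := ((hdda.div hda hat0).mul_const r).derivWithin (hS t ht)
  simp only [Function.comp_def, id, Pi.div_apply, Pi.pow_apply, Pi.div_def,
    Pi.mul_def, Pi.pow_def] at hρ_r hρ_t hu_t
  rw [hu_r, hρ_r, hρ_t, hu_t, integral_exp_comp_div_mul hK hy hode hat hr]
  constructor
  · field_simp
    ring
  · field_simp
    ring
end

section
/- Let λ > 0, a₀ > 0, a₁ ∈ ℝ, and let a : [0,T) → ℝ be a maximal positive C² solution of the Emden equation a''(t) = -λ/a(t), a(0) = a₀, a'(0) = a₁, with finite blowup time T < ∞ and a(t) → 0 as t → T⁻. Then for every exponent η with 0 < η < 2 there exist a constant c > 0 and a time t₁ ∈ [0,T) such that a(t)² ≤ (1/c)·(T-t)^η for all t ∈ [t₁,T). Consequently, for the blowup solution with density ρ(t,0) = e^{y(0)}/a(t)² at the origin, lim inf_{t→T⁻} ρ(t,0)·(T-t)^η > 0 for every η < 2. -/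
open Real Filter

/-- Conservation of energy for `a'' = -lam / a`. -/
theorem exists_energy_eq_of_emden {lam s T : ℝ} {a v : ℝ → ℝ}
    (hpos : ∀ t ∈ Set.Ioo s T, 0 < a t)
    (hav : ∀ t ∈ Set.Ioo s T, HasDerivAt a (v t) t)
    (hv : ∀ t ∈ Set.Ioo s T, HasDerivAt v (-lam / a t) t) :
    ∃ E : ℝ, ∀ t ∈ Set.Ioo s T, v t ^ 2 + 2 * lam * log (a t) = E := by
  have hderiv : ∀ t ∈ Set.Ioo s T,
      HasDerivAt (fun t => v t ^ 2 + 2 * lam * log (a t)) 0 t := by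
    intro t ht
    have hne := (hpos t ht).ne'
    refine (((hv t ht).pow 2).add (((hav t ht).log hne).const_mul (2 * lam))).congr_deriv ?_
    field_simp
    norm_num
  exact isOpen_Ioo.exists_is_const_of_deriv_eq_zero isPreconnected_Ioo
    (fun t ht => (hderiv t ht).differentiableAt.differentiableWithinAt)
    (fun t ht => (hderiv t ht).deriv)

/-- Logarithmic growth of the speed is absorbed by any positive power of the position. -/
theorem rpow_mul_abs_le_of_energy {lam E x w p : ℝ} (hlam : 0 < lam) (hx : 0 < x) (hx1 : x ≤ 1)
    (hp : 0 < p) (hE : w ^ 2 + 2 * lam * log x = E) :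
    x ^ p * |w| ≤ √(|E| + lam / p) := by
  apply Real.le_sqrt_of_sq_le
  have hlog : -log x ≤ (x ^ (2 * p))⁻¹ / (2 * p) := by
    have h := Real.log_le_rpow_div (inv_pos.2 hx).le (by positivity : 0 < 2 * p)
    rwa [Real.log_inv, Real.inv_rpow hx.le] at h
  have hsq : (x ^ p) ^ 2 = x ^ (2 * p) := by
    rw [← Real.rpow_natCast, ← Real.rpow_mul hx.le]
    norm_num [mul_comm]
  have hq : 0 < x ^ (2 * p) := Real.rpow_pos_of_pos hx _
  have hq1 : x ^ (2 * p) ≤ 1 := Real.rpow_le_one hx.le hx1 (by positivity)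
  calc (x ^ p * |w|) ^ 2 = x ^ (2 * p) * E + 2 * lam * (x ^ (2 * p) * -log x) := by
        rw [mul_pow, sq_abs, hsq, ← hE]
        ring
    _ ≤ 1 * |E| + 2 * lam * (x ^ (2 * p) * ((x ^ (2 * p))⁻¹ / (2 * p))) := by
        have := (mul_le_mul_of_nonneg_left (le_abs_self E) hq.le).trans
          (mul_le_mul_of_nonneg_right hq1 (abs_nonneg E))
        gcongr
    _ = |E| + lam / p := by
        field_simp

/-- A function on `(s, T)` that vanishes at `T⁻` and whose derivative is bounded by `M` is at most
`M * (T - t)`. -/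
theorem le_mul_sub_of_abs_deriv_le {s T M : ℝ} {f f' : ℝ → ℝ}
    (hf : ∀ t ∈ Set.Ioo s T, HasDerivAt f (f' t) t) (hM : ∀ t ∈ Set.Ioo s T, |f' t| ≤ M)
    (hlim : Tendsto f (nhdsWithin T (Set.Iio T)) (nhds 0)) {t : ℝ} (ht : t ∈ Set.Ioo s T) :
    f t ≤ M * (T - t) := by
  have hM0 : 0 ≤ M := (abs_nonneg _).trans (hM t ht)
  have hclose : ∀ᶠ u in nhdsWithin T (Set.Iio T), f t - M * (T - t) ≤ f u := by
    filter_upwards [Ioo_mem_nhdsLT ht.2] with u hu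
    have h := (convex_Ioo s T).norm_image_sub_le_of_norm_hasDerivWithin_le
      (fun x hx => (hf x hx).hasDerivWithinAt) hM (Set.mem_Ioo.2 ⟨ht.1.trans hu.1, hu.2⟩) ht
    rw [Real.norm_eq_abs, Real.norm_eq_abs, abs_of_neg (sub_neg.2 hu.1)] at h
    have h' := (le_abs_self _).trans h
    nlinarith [hu.2]
  linarith [ge_of_tendsto hlim hclose]

/-- Near a collapse time `T`, solutions of `a'' = -lam / a` vanish at least as fast as
`(T - t) ^ (η / 2)`, for every `η < 2`. -/
theorem sq_le_rpow_of_emden {lam s T η : ℝ} {a v : ℝ → ℝ} (hlam : 0 < lam)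
    (hpos : ∀ t ∈ Set.Ioo s T, 0 < a t) (hle : ∀ t ∈ Set.Ioo s T, a t ≤ 1)
    (hav : ∀ t ∈ Set.Ioo s T, HasDerivAt a (v t) t)
    (hv : ∀ t ∈ Set.Ioo s T, HasDerivAt v (-lam / a t) t)
    (hlim : Tendsto a (nhdsWithin T (Set.Iio T)) (nhds 0)) (hη : 0 < η) (hη2 : η < 2) :
    ∃ C : ℝ, 0 < C ∧ ∀ t ∈ Set.Ioo s T, a t ^ 2 ≤ C * (T - t) ^ η := by
  obtain ⟨E, hE⟩ := exists_energy_eq_of_emden hpos hav hv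
  have hp : 0 < 2 / η - 1 := by
    rw [sub_pos, lt_div_iff₀ hη]
    linarith
  have hK : 0 < |E| + lam / (2 / η - 1) := by positivity
  have hq : 0 < 2 / η := by positivity
  set M := 2 / η * √(|E| + lam / (2 / η - 1)) with hMdef
  have hM : 0 < M := by positivity
  refine ⟨M ^ η, Real.rpow_pos_of_pos hM _, fun t ht => ?_⟩
  have hbound : ∀ u ∈ Set.Ioo s T, |v u * (2 / η) * a u ^ (2 / η - 1)| ≤ M := by
    intro u hu
    rw [abs_mul, abs_mul, abs_of_pos hq, abs_of_pos (Real.rpow_pos_of_pos (hpos u hu) _), hMdef]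
    calc |v u| * (2 / η) * a u ^ (2 / η - 1)
        = 2 / η * (a u ^ (2 / η - 1) * |v u|) := by ring
      _ ≤ _ := mul_le_mul_of_nonneg_left
        (rpow_mul_abs_le_of_energy hlam (hpos u hu) (hle u hu) hp (hE u hu)) hq.le
  have hlim' : Tendsto (fun u => a u ^ (2 / η)) (nhdsWithin T (Set.Iio T)) (nhds 0) := by
    simpa [Real.zero_rpow hq.ne'] using hlim.rpow_const (Or.inr hq.le)
  have hlin := le_mul_sub_of_abs_deriv_le
    (fun u hu => (hav u hu).rpow_const (Or.inl (hpos u hu).ne')) hbound hlim' ht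
  calc a t ^ 2 = (a t ^ (2 / η)) ^ η := by
        rw [← Real.rpow_mul (hpos t ht).le, div_mul_cancel₀ _ hη.ne', Real.rpow_two]
    _ ≤ (M * (T - t)) ^ η :=
        Real.rpow_le_rpow (Real.rpow_nonneg (hpos t ht).le _) hlin hη.le
    _ = M ^ η * (T - t) ^ η := Real.mul_rpow hM.le (sub_nonneg.2 ht.2.le)

/- STATEMENT 12: Let `a` be a maximal positive `C²` solution on `[0,T)` of the Emden equation
`a'' = -λ/a`, `a(0) = a₀ > 0`, `a'(0) = a₁`, with `λ > 0`, finite blowup time `T < ∞` and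
`a(t) → 0` as `t → T⁻`. Then for every `η` with `0 < η < 2` there are `c > 0` and
`t₁ ∈ [0,T)` with `a(t)² ≤ (1/c)·(T-t)^η` on `[t₁,T)`; consequently the blowup density
`ρ(t,0) = e^{y(0)}/a(t)²` satisfies `lim inf_{t→T⁻} ρ(t,0)·(T-t)^η > 0` (i.e. it is
eventually bounded below by a positive constant) for every such `η`. -/
theorem emden_blowup_rate (lam a₀ a₁ T : ℝ) (hlam : 0 < lam) (ha₀ : 0 < a₀) (hT : 0 < T)
    (a : ℝ → ℝ)
    (ha : ContDiffOn ℝ 2 a (Set.Ico 0 T))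
    (hapos : ∀ t ∈ Set.Ico 0 T, 0 < a t)
    (hemden : ∀ t ∈ Set.Ico 0 T,
      derivWithin (derivWithin a (Set.Ico 0 T)) (Set.Ico 0 T) t = -lam / a t)
    (h0 : a 0 = a₀)
    (h1 : derivWithin a (Set.Ico 0 T) 0 = a₁)
    (hblow : Tendsto a (nhdsWithin T (Set.Iio T)) (nhds 0)) :
    ∀ η : ℝ, 0 < η → η < 2 →
      (∃ c : ℝ, 0 < c ∧ ∃ t₁ ∈ Set.Ico 0 T,
        ∀ t ∈ Set.Ico t₁ T, (a t) ^ 2 ≤ (1 / c) * (T - t) ^ η) ∧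
      ∀ y0 : ℝ, ∃ c : ℝ, 0 < c ∧
        ∀ᶠ t in nhdsWithin T (Set.Iio T),
          c ≤ (Real.exp y0 / (a t) ^ 2) * (T - t) ^ η := by
  intro η hη hη2
  have hnhds : ∀ t ∈ Set.Ioo 0 T, Set.Ico 0 T ∈ nhds t := fun t ht => Ico_mem_nhds ht.1 ht.2
  have hav : ∀ t ∈ Set.Ioo 0 T, HasDerivAt a (derivWithin a (Set.Ico 0 T) t) t := fun t ht =>
    ((ha.differentiableOn (by norm_num)) t (Set.Ioo_subset_Ico_self ht)).hasDerivWithinAt.hasDerivAt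
      (hnhds t ht)
  have hdiff : DifferentiableOn ℝ (derivWithin a (Set.Ico 0 T)) (Set.Ico 0 T) :=
    (ha.derivWithin (uniqueDiffOn_Ico 0 T) (m := 1) (by norm_num)).differentiableOn (by norm_num)
  have hv : ∀ t ∈ Set.Ioo 0 T,
      HasDerivAt (derivWithin a (Set.Ico 0 T)) (-lam / a t) t := fun t ht => by
    rw [← hemden t (Set.Ioo_subset_Ico_self ht)]
    exact (hdiff t (Set.Ioo_subset_Ico_self ht)).hasDerivWithinAt.hasDerivAt (hnhds t ht)
  obtain ⟨s, hs, hsub⟩ := (mem_nhdsLT_iff_exists_mem_Ico_Ioo_subset hT).1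
    (hblow.eventually (eventually_le_nhds one_pos))
  have hIoo : Set.Ioo s T ⊆ Set.Ioo 0 T := Set.Ioo_subset_Ioo_left hs.1
  obtain ⟨C, hC, hbound⟩ := sq_le_rpow_of_emden hlam
    (fun t ht => hapos t (Set.Ioo_subset_Ico_self (hIoo ht))) (fun t ht => hsub ht)
    (fun t ht => hav t (hIoo ht)) (fun t ht => hv t (hIoo ht)) hblow hη hη2
  refine ⟨⟨1 / C, by positivity, (s + T) / 2, ⟨by linarith [hs.1], by linarith [hs.2]⟩,
    fun t ht => ?_⟩, fun y0 => ⟨exp y0 / C, by positivity, ?_⟩⟩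
  · rw [one_div_one_div]
    exact hbound t ⟨by linarith [hs.2, ht.1], ht.2⟩
  · filter_upwards [Ioo_mem_nhdsLT hs.2] with t ht
    have hat := hapos t (Set.Ioo_subset_Ico_self (hIoo ht))
    rw [div_mul_eq_mul_div, div_le_div_iff₀ hC (by positivity), mul_assoc]
    gcongr
    rw [mul_comm]
    exact hbound t ht
end
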